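/- Let a < b be real numbers and let Υ : ℝ → ℝ be a continuously differentiable function with Υ'(z) > 0 for every z ∈ ℝ that maps ℝ bijectively onto the open interval (a, b). Then there exists an extended-real-valued function R : ℝ → ℝ ∪ {+∞} such that: (i) R is proper and convex, is finite, strictly convex, and differentiable on (a, b), and satisfies R(y) = +∞ whenever y < a or y > b; (ii) R'(Υ(z)) = z for every z ∈ ℝ, i.e., Υ is the inverse of the derivative R' on (a, b); (iii) the convex conjugate R*(z) = sup_{y ∈ ℝ} (z·y − R(y)) is finite for every z ∈ ℝ and is differentiable with (R*)'(z) = Υ(z) for all z ∈ ℝ; and (iv) R is supercoercive: for every M > 0 there exists N > 0 such that R(y) ≥ M·|y| for all y with |y| ≥ N (where +∞ ≥ M·|y| by convention). -/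

import Mathlib

open Set Filter Topology

theorem tangent_le_of_hasDerivAt_monotone {P f : ℝ → ℝ} (hP : ∀ z, HasDerivAt P (f z) z)
    (hf : Monotone f) (z w : ℝ) : P w + f w * (z - w) ≤ P z := by
  have hc : Continuous P := continuous_iff_continuousAt.2 fun x => (hP x).continuousAt
  rcases lt_trichotomy w z with h | rfl | h
  · obtain ⟨c, hc, he⟩ := exists_hasDerivAt_eq_slope P f h hc.continuousOn fun x _ => hP x
    rw [eq_div_iff (by linarith)] at he
    nlinarith [hf hc.1.le]
  · simp
  · obtain ⟨c, hc, he⟩ := exists_hasDerivAt_eq_slope P f h hc.continuousOn fun x _ => hP x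
    rw [eq_div_iff (by linarith)] at he
    nlinarith [hf hc.2.le]

open Classical in
/-- The extension of a real function on a set by `⊤` outside of it. -/
noncomputable def extendTop (s : Set ℝ) (g : ℝ → ℝ) (y : ℝ) : EReal :=
  if y ∈ s then (g y : EReal) else ⊤

theorem extendTop_of_mem {s : Set ℝ} {y : ℝ} (g : ℝ → ℝ) (hy : y ∈ s) :
    extendTop s g y = (g y : EReal) := if_pos hy

theorem extendTop_of_notMem {s : Set ℝ} {y : ℝ} (g : ℝ → ℝ) (hy : y ∉ s) :
    extendTop s g y = ⊤ := if_neg hy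

theorem extendTop_ne_bot (s : Set ℝ) (g : ℝ → ℝ) (y : ℝ) : extendTop s g y ≠ ⊥ := by
  unfold extendTop
  split_ifs <;> simp

theorem coe_mul_extendTop_ne_bot (s : Set ℝ) (g : ℝ → ℝ) (y : ℝ) {t : ℝ} (ht : 0 < t) :
    (t : EReal) * extendTop s g y ≠ ⊥ := by
  unfold extendTop
  split_ifs
  · rw [← EReal.coe_mul]
    exact EReal.coe_ne_bot _
  · rw [EReal.coe_mul_top_of_pos ht]
    exact top_ne_bot

theorem extendTop_convex {s : Set ℝ} {g : ℝ → ℝ} (hg : ConvexOn ℝ s g) (x y t : ℝ)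
    (ht0 : 0 ≤ t) (ht1 : t ≤ 1) :
    extendTop s g ((1 - t) * x + t * y) ≤
      ((1 - t : ℝ) : EReal) * extendTop s g x + (t : EReal) * extendTop s g y := by
  rcases ht0.eq_or_lt with rfl | h0
  · simp
  rcases ht1.eq_or_lt with rfl | h1
  · simp
  have h1' : 0 < 1 - t := by linarith
  by_cases hx : x ∈ s
  · by_cases hy : y ∈ s
    · have hmem := hg.1 hx hy h1'.le ht0 (by ring)
      have hle := hg.2 hx hy h1'.le ht0 (by ring)
      simp only [smul_eq_mul] at hmem hle
      rw [extendTop_of_mem g hx, extendTop_of_mem g hy, extendTop_of_mem g hmem]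
      exact_mod_cast hle
    · rw [extendTop_of_notMem g hy, EReal.coe_mul_top_of_pos h0,
        EReal.add_top_of_ne_bot (coe_mul_extendTop_ne_bot s g x h1')]
      exact le_top
  · rw [extendTop_of_notMem g hx, EReal.coe_mul_top_of_pos h1',
      EReal.top_add_of_ne_bot (coe_mul_extendTop_ne_bot s g y h0)]
    exact le_top

/-- Proposition 3.6, pointwise form. For a `C¹` strictly increasing
bijection `Υ : ℝ → (a, b)`, there exists a proper convex extended-real-valued
function `R : ℝ → ℝ ∪ {+∞}` that is finite, strictly convex and differentiable on
`(a, b)`, equals `+∞` outside `[a, b]`, whose derivative is inverted by `Υ`, whose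
convex conjugate is finite and differentiable with derivative `Υ`, and which is
supercoercive. -/
theorem fospg_statement0
    (a b : ℝ) (hab : a < b) (Υ : ℝ → ℝ)
    (hΥC1 : ContDiff ℝ 1 Υ) (hΥ' : ∀ z : ℝ, 0 < deriv Υ z)
    (hΥinj : Function.Injective Υ) (hΥrange : Set.range Υ = Set.Ioo a b) :
    ∃ (R : ℝ → EReal) (g g' : ℝ → ℝ),
      -- (i) R is proper ...
      (∀ y : ℝ, R y ≠ ⊥) ∧ (∃ y : ℝ, R y ≠ ⊤) ∧
      -- ... convex (in the extended-real sense) ...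
      (∀ x y t : ℝ, 0 ≤ t → t ≤ 1 →
        R ((1 - t) * x + t * y) ≤ ((1 - t : ℝ) : EReal) * R x + ((t : ℝ) : EReal) * R y) ∧
      -- ... finite on (a, b), where it is given by the real-valued function g ...
      (∀ y ∈ Set.Ioo a b, R y = ((g y : ℝ) : EReal)) ∧
      -- ... strictly convex and differentiable on (a, b) ...
      StrictConvexOn ℝ (Set.Ioo a b) g ∧
      (∀ y ∈ Set.Ioo a b, HasDerivAt g (g' y) y) ∧
      -- ... and R(y) = +∞ whenever y < a or y > b
      (∀ y : ℝ, (y < a ∨ b < y) → R y = ⊤) ∧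
      -- (ii) Υ is the inverse of the derivative R' on (a, b)
      (∀ z : ℝ, g' (Υ z) = z) ∧
      -- (iii) the convex conjugate is finite everywhere and differentiable with
      -- derivative Υ
      (∃ Rstar : ℝ → ℝ,
        (∀ z : ℝ, (⨆ y : ℝ, (((z * y : ℝ) : EReal) - R y)) = ((Rstar z : ℝ) : EReal)) ∧
        (∀ z : ℝ, HasDerivAt Rstar (Υ z) z)) ∧
      -- (iv) R is supercoercive
      (∀ M : ℝ, 0 < M → ∃ N : ℝ, 0 < N ∧
        ∀ y : ℝ, N ≤ |y| → ((M * |y| : ℝ) : EReal) ≤ R y) := by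
  have hcont : Continuous Υ := hΥC1.continuous
  have hmono : StrictMono Υ := strictMono_of_deriv_pos hΥ'
  have hmem (z : ℝ) : Υ z ∈ Ioo a b := hΥrange ▸ mem_range_self z
  have hsurj {y : ℝ} (hy : y ∈ Ioo a b) : ∃ z, Υ z = y := by rwa [← hΥrange] at hy
  set P : ℝ → ℝ := fun z => ∫ t in (0 : ℝ)..z, Υ t
  have hP (z : ℝ) : HasDerivAt P (Υ z) z := hcont.integral_hasStrictDerivAt 0 z |>.hasDerivAt
  set V : ℝ → ℝ := Function.invFun Υ
  have hV (z : ℝ) : V (Υ z) = z := Function.leftInverse_invFun hΥinj z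
  set g : ℝ → ℝ := fun y => y * V y - P (V y) with hg_def
  have hg : ∀ y ∈ Ioo a b, HasDerivAt g (V y) y := by
    intro y hy
    obtain ⟨z, rfl⟩ := hsurj hy
    have hVd : HasDerivAt V (deriv Υ z)⁻¹ (Υ z) :=
      ((hΥC1.contDiffAt.hasStrictDerivAt one_ne_zero).to_local_left_inverse
        (hΥ' z).ne' (Eventually.of_forall hV)).hasDerivAt
    have hPV := (hP (V (Υ z))).comp (Υ z) hVd
    exact (((hasDerivAt_id (Υ z)).mul hVd).sub hPV).congr_deriv (by simp [hV])
  have hstrict : StrictConvexOn ℝ (Ioo a b) g := by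
    refine StrictMonoOn.strictConvexOn_of_deriv (convex_Ioo a b)
      (fun y hy => (hg y hy).continuousAt.continuousWithinAt) ?_
    rw [interior_Ioo]
    intro x hx y hy hxy
    rw [(hg x hx).deriv, (hg y hy).deriv]
    obtain ⟨z, rfl⟩ := hsurj hx
    obtain ⟨w, rfl⟩ := hsurj hy
    rwa [hV, hV, ← hmono.lt_iff_lt]
  refine ⟨extendTop (Ioo a b) g, g, V, extendTop_ne_bot _ g, ⟨Υ 0, ?_⟩,
    extendTop_convex hstrict.convexOn, fun y => extendTop_of_mem g, hstrict, hg, ?_, hV,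
    ⟨P, fun z => le_antisymm (iSup_le fun y => ?_) ?_, hP⟩, fun M _ => ?_⟩
  · rw [extendTop_of_mem g (hmem 0)]
    exact EReal.coe_ne_top _
  · rintro y (hy | hy)
    · exact extendTop_of_notMem g fun h => (h.1.trans hy).false
    · exact extendTop_of_notMem g fun h => (h.2.trans hy).false
  · by_cases hy : y ∈ Ioo a b
    · rw [extendTop_of_mem g hy, ← EReal.coe_sub, EReal.coe_le_coe_iff]
      obtain ⟨w, rfl⟩ := hsurj hy
      have := tangent_le_of_hasDerivAt_monotone hP hmono.monotone z w
      simp only [hg_def, hV]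
      linarith
    · rw [extendTop_of_notMem g hy, EReal.sub_top]
      exact bot_le
  · refine le_iSup_of_le (Υ z) ?_
    rw [extendTop_of_mem g (hmem z), ← EReal.coe_sub, EReal.coe_le_coe_iff]
    simp only [hg_def, hV]
    linarith
  · refine ⟨max |a| |b| + 1, by positivity, fun y hy => ?_⟩
    rw [extendTop_of_notMem g fun h => ?_]
    · exact le_top
    · have := abs_le_max_abs_abs h.1.le h.2.le
      linarith
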